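/- (Bound on the Riemannian gradient of the Lyapunov function.) Under the stated assumptions, if β > max{β′, β″}, then there exist constants ϱ₁, ϱ₂, ϱ₃ > 0 such that for all k, ‖grad Ψ(x^{k+1}, x^k, λ^{k+1}, λ^k)‖ ≤ ϱ₁‖x^{k+1} − x^k‖ + ϱ₂‖x^k − x^{k−1}‖ + ϱ₃‖λ^{k+1} − λ^k‖, where grad Ψ denotes the Riemannian gradient of Ψ(x, y, λ, μ) = L_β(x,λ) + (α₁/(τβ))‖λ−μ‖² + Σᵢ₌₁⁴ ‖xᵢ−yᵢ‖²_{Mᵢ} on the product manifold in which the x₁ and y₁ variables lie on M: it equals the Euclidean gradient with its x₁- and y₁-components replaced by their orthogonal projections onto the tangent spaces of M at x₁^{k+1} and x₁^k respectively (acting blockwise on each 4-block by v ↦ v − ⟨pᵢ,vᵢ⟩pᵢ). -/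

import Mathlib

open scoped RealInnerProductSpace
open Matrix

noncomputable section

/-- `ℝ^{4n}`, regarded as `n` blocks of `ℝ⁴`. -/
abbrev E4 (n : ℕ) := EuclideanSpace ℝ (Fin n × Fin 4)

/-- `ℝ^{3n}`, regarded as `n` blocks of `ℝ³`. -/
abbrev E3 (n : ℕ) := EuclideanSpace ℝ (Fin n × Fin 3)

/-- The product of `n` unit spheres in `ℝ⁴`: each 4-coordinate block has norm 1. -/
def Msph (n : ℕ) : Set (E4 n) := {x | ∀ i : Fin n, ∑ j : Fin 4, x (i, j) ^ 2 = 1}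

/-- Partial gradient of `f` w.r.t. its first block. -/
def grad1f {n : ℕ} (f : E4 n → E4 n → E3 n → E3 n → ℝ) (a b : E4 n) (c d : E3 n) : E4 n :=
  gradient (fun y => f y b c d) a

/-- Partial gradient of `f` w.r.t. its second block. -/
def grad2f {n : ℕ} (f : E4 n → E4 n → E3 n → E3 n → ℝ) (a b : E4 n) (c d : E3 n) : E4 n :=
  gradient (fun y => f a y c d) b

/-- Partial gradient of `f` w.r.t. its third block. -/
def grad3f {n : ℕ} (f : E4 n → E4 n → E3 n → E3 n → ℝ) (a b : E4 n) (c d : E3 n) : E3 n :=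
  gradient (fun y => f a b y d) c

/-- Partial gradient of `f` w.r.t. its fourth block. -/
def grad4f {n : ℕ} (f : E4 n → E4 n → E3 n → E3 n → ℝ) (a b : E4 n) (c d : E3 n) : E3 n :=
  gradient (fun y => f a b c y) d

/-- Partial gradient of `g` w.r.t. its first block. -/
def grad1g {n : ℕ} (g : E4 n → E4 n → ℝ) (a b : E4 n) : E4 n :=
  gradient (fun y => g y b) a

/-- Partial gradient of `g` w.r.t. its second block. -/
def grad2g {n : ℕ} (g : E4 n → E4 n → ℝ) (a b : E4 n) : E4 n :=
  gradient (fun y => g a y) b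

/-- The quadratic form `‖v‖²_H = ⟨v, Hv⟩` of a matrix `H`. -/
def qf {ι : Type*} [Fintype ι] [DecidableEq ι] (H : Matrix ι ι ℝ)
    (v : EuclideanSpace ℝ ι) : ℝ :=
  ⟪v, Matrix.toEuclideanLin H v⟫

/-- The augmented Lagrangian
`L_β(x,λ) = f + g − ⟨λ₁, x₁−x₂⟩ − ⟨λ₂, x₃−x₄⟩ + (β/2)(‖x₁−x₂‖² + ‖x₃−x₄‖²)`. -/
def augL {n : ℕ} (f : E4 n → E4 n → E3 n → E3 n → ℝ) (g : E4 n → E4 n → ℝ) (β : ℝ)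
    (x1 x2 : E4 n) (x3 x4 : E3 n) (l1 : E4 n) (l2 : E3 n) : ℝ :=
  f x1 x2 x3 x4 + g x1 x2 - ⟪l1, x1 - x2⟫ - ⟪l2, x3 - x4⟫ +
    β / 2 * (‖x1 - x2‖ ^ 2 + ‖x3 - x4‖ ^ 2)


/-- Blockwise projection onto the tangent space of the product of spheres at `p`:
on each 4-block, `v ↦ v − ⟨pᵢ, vᵢ⟩ pᵢ`. -/
def projM {n : ℕ} (p v : E4 n) : E4 n :=
  (WithLp.equiv 2 ((Fin n × Fin 4) → ℝ)).symm fun ij =>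
    v ij - (∑ j' : Fin 4, p (ij.1, j') * v (ij.1, j')) * p ij

/-- The Lyapunov function
`Ψ(x, y, λ, μ) = L_β(x,λ) + (α₁/(τβ))‖λ−μ‖² + Σᵢ‖xᵢ−yᵢ‖²_{Mᵢ}`. -/
def Psi {n : ℕ} (f : E4 n → E4 n → E3 n → E3 n → ℝ) (g : E4 n → E4 n → ℝ)
    (β α1 τ : ℝ)
    (M1 M2 : Matrix (Fin n × Fin 4) (Fin n × Fin 4) ℝ)
    (M3 M4 : Matrix (Fin n × Fin 3) (Fin n × Fin 3) ℝ)
    (x1 x2 : E4 n) (x3 x4 : E3 n) (y1 y2 : E4 n) (y3 y4 : E3 n)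
    (l1 : E4 n) (l2 : E3 n) (m1 : E4 n) (m2 : E3 n) : ℝ :=
  augL f g β x1 x2 x3 x4 l1 l2 +
    α1 / (τ * β) * (‖l1 - m1‖ ^ 2 + ‖l2 - m2‖ ^ 2) +
    (qf M1 (x1 - y1) + qf M2 (x2 - y2) + qf M3 (x3 - y3) + qf M4 (x4 - y4))

section GradientRules

variable {E : Type*} [NormedAddCommGroup E] [InnerProductSpace ℝ E] [CompleteSpace E]
  {u v : E → ℝ} {a b p : E}

theorem HasGradientAt.fun_add (hu : HasGradientAt u a p) (hv : HasGradientAt v b p) :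
    HasGradientAt (fun y => u y + v y) (a + b) p := by
  rw [hasGradientAt_iff_hasFDerivAt, map_add]
  exact hu.hasFDerivAt.add hv.hasFDerivAt

theorem HasGradientAt.fun_sub (hu : HasGradientAt u a p) (hv : HasGradientAt v b p) :
    HasGradientAt (fun y => u y - v y) (a - b) p := by
  rw [hasGradientAt_iff_hasFDerivAt, map_sub]
  exact hu.hasFDerivAt.sub hv.hasFDerivAt

theorem HasGradientAt.fun_add_const (hu : HasGradientAt u a p) (c : ℝ) :
    HasGradientAt (fun y => u y + c) a p := by
  simpa using hu.fun_add (hasGradientAt_const p c)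

theorem HasGradientAt.fun_const_add (hu : HasGradientAt u a p) (c : ℝ) :
    HasGradientAt (fun y => c + u y) a p := by
  simpa using (hasGradientAt_const p c).fun_add hu

theorem HasGradientAt.fun_sub_const (hu : HasGradientAt u a p) (c : ℝ) :
    HasGradientAt (fun y => u y - c) a p := by
  simpa using hu.fun_sub (hasGradientAt_const p c)

theorem HasGradientAt.fun_const_sub (hu : HasGradientAt u a p) (c : ℝ) :
    HasGradientAt (fun y => c - u y) (-a) p := by
  simpa using (hasGradientAt_const p c).fun_sub hu

theorem HasGradientAt.fun_const_mul (hu : HasGradientAt u a p) (c : ℝ) :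
    HasGradientAt (fun y => c * u y) (c • a) p := by
  rw [hasGradientAt_iff_hasFDerivAt, map_smul]
  exact hu.hasFDerivAt.const_mul c

theorem hasGradientAt_inner_sub_right (l c p : E) :
    HasGradientAt (fun y => ⟪l, y - c⟫) l p := by
  rw [hasGradientAt_iff_hasFDerivAt]
  exact (innerSL ℝ l).hasFDerivAt.comp p ((hasFDerivAt_id p).sub_const c)

theorem hasGradientAt_inner_const_sub_right (l c p : E) :
    HasGradientAt (fun y => ⟪l, c - y⟫) (-l) p := by
  have h := (hasGradientAt_inner_sub_right l c p).fun_const_sub 0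
  refine h.congr_of_eventuallyEq (Filter.Eventually.of_forall fun y => ?_)
  simp [inner_sub_right]

theorem hasGradientAt_inner_left (c p : E) : HasGradientAt (fun y => ⟪y, c⟫) c p := by
  have h := hasGradientAt_inner_sub_right c 0 p
  refine h.congr_of_eventuallyEq (Filter.Eventually.of_forall fun y => ?_)
  simp [real_inner_comm]

theorem hasGradientAt_norm_sub_sq (c p : E) :
    HasGradientAt (fun y => ‖y - c‖ ^ 2) ((2 : ℝ) • (p - c)) p := by
  rw [hasGradientAt_iff_hasFDerivAt]
  refine ((hasFDerivAt_id p).sub_const c).norm_sq.congr_fderiv ?_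
  ext w
  simp

theorem hasGradientAt_norm_const_sub_sq (c p : E) :
    HasGradientAt (fun y => ‖c - y‖ ^ 2) ((2 : ℝ) • (p - c)) p := by
  simpa only [norm_sub_rev] using hasGradientAt_norm_sub_sq c p

theorem HasGradientAt.eq_zero_of_forall_le (hu : HasGradientAt u a p) (h : ∀ y, u p ≤ u y) :
    a = 0 := by
  have h0 := IsLocalMin.hasFDerivAt_eq_zero (Filter.Eventually.of_forall h) hu.hasFDerivAt
  simpa using h0

end GradientRules

section QuadraticForm

variable {ι : Type*} [Fintype ι] [DecidableEq ι]

/-- The derivative map `H + Hᵀ` of the quadratic form of `H`. -/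
def qfGrad (H : Matrix ι ι ℝ) : EuclideanSpace ℝ ι →L[ℝ] EuclideanSpace ℝ ι :=
  Matrix.toEuclideanCLM (𝕜 := ℝ) H + ContinuousLinearMap.adjoint (Matrix.toEuclideanCLM (𝕜 := ℝ) H)

theorem hasGradientAt_qf_sub (H : Matrix ι ι ℝ) (c p : EuclideanSpace ℝ ι) :
    HasGradientAt (fun y => qf H (y - c)) (qfGrad H (p - c)) p := by
  rw [hasGradientAt_iff_hasFDerivAt]
  have h1 : HasFDerivAt (fun y : EuclideanSpace ℝ ι => y - c) (ContinuousLinearMap.id ℝ _) p :=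
    (hasFDerivAt_id p).sub_const c
  have h2 := (Matrix.toEuclideanCLM (𝕜 := ℝ) H).hasFDerivAt.comp p h1
  refine (h1.inner ℝ h2).congr_fderiv ?_
  ext w
  simp only [qfGrad, ContinuousLinearMap.comp_apply, ContinuousLinearMap.prod_apply,
    ContinuousLinearMap.id_apply, fderivInnerCLM_apply, InnerProductSpace.toDual_apply_apply,
    _root_.add_apply, inner_add_left, ContinuousLinearMap.adjoint_inner_left,
    Function.comp_apply]
  rw [real_inner_comm w, add_comm]

theorem hasGradientAt_qf_const_sub (H : Matrix ι ι ℝ) (c p : EuclideanSpace ℝ ι) :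
    HasGradientAt (fun y => qf H (c - y)) (qfGrad H (p - c)) p := by
  refine (hasGradientAt_qf_sub H c p).congr_of_eventuallyEq
    (Filter.Eventually.of_forall fun y => ?_)
  simp only [qf]
  rw [← neg_sub y c, map_neg, inner_neg_neg]

end QuadraticForm

section SphereProduct

variable {n : ℕ}

theorem projM_apply (p v : E4 n) (i : Fin n) (j : Fin 4) :
    projM p v (i, j) = v (i, j) - (∑ j', p (i, j') * v (i, j')) * p (i, j) := rfl

theorem projM_sub (p v w : E4 n) : projM p (v - w) = projM p v - projM p w := by
  ext ⟨i, j⟩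
  simp only [projM_apply, PiLp.sub_apply, mul_sub, Finset.sum_sub_distrib]
  ring

theorem sum_mul_projM {p : E4 n} (hp : p ∈ Msph n) (v : E4 n) (i : Fin n) :
    ∑ j, p (i, j) * projM p v (i, j) = 0 := by
  have h : ∑ j, p (i, j) * projM p v (i, j) =
      ∑ j, p (i, j) * v (i, j) - (∑ j, p (i, j) * v (i, j)) * ∑ j, p (i, j) ^ 2 := by
    rw [Finset.mul_sum, ← Finset.sum_sub_distrib]
    exact Finset.sum_congr rfl fun j _ => by rw [projM_apply]; ring
  rw [h, hp i, mul_one, sub_self]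

theorem inner_projM {p : E4 n} (hp : p ∈ Msph n) (v : E4 n) :
    ⟪v, projM p v⟫ = ‖projM p v‖ ^ 2 := by
  rw [← real_inner_self_eq_norm_sq, ← sub_eq_zero, ← inner_sub_left, PiLp.inner_apply,
    Fintype.sum_prod_type]
  refine Finset.sum_eq_zero fun i _ => ?_
  have h := congrArg ((∑ j, p (i, j) * v (i, j)) * ·) (sum_mul_projM hp v i)
  simp only [mul_zero, Finset.mul_sum] at h
  rw [← h]
  refine Finset.sum_congr rfl fun j _ => ?_
  rw [PiLp.sub_apply, projM_apply, RCLike.inner_apply, conj_trivial]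
  ring

theorem norm_projM_le {p : E4 n} (hp : p ∈ Msph n) (v : E4 n) : ‖projM p v‖ ≤ ‖v‖ := by
  have h := real_inner_le_norm v (projM p v)
  rw [inner_projM hp, sq] at h
  by_contra! hlt
  nlinarith [norm_nonneg v, norm_nonneg (projM p v)]

/-- A curve on the product of spheres through `p` with velocity `v`
(when `v` is tangent at `p`). -/
def sphereCurve (p v : E4 n) (t : ℝ) : E4 n :=
  WithLp.toLp 2 fun ij =>
    (p ij + t * v ij) / Real.sqrt (1 + t ^ 2 * ∑ j, v (ij.1, j) ^ 2)

theorem sphereCurve_apply (p v : E4 n) (t : ℝ) (ij : Fin n × Fin 4) :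
    sphereCurve p v t ij =
      (p ij + t * v ij) / Real.sqrt (1 + t ^ 2 * ∑ j, v (ij.1, j) ^ 2) := rfl

theorem sphereCurve_zero (p v : E4 n) : sphereCurve p v 0 = p := by
  ext ij
  simp [sphereCurve_apply]

theorem sphereCurve_mem {p v : E4 n} (hp : p ∈ Msph n)
    (hv : ∀ i, ∑ j, p (i, j) * v (i, j) = 0) (t : ℝ) : sphereCurve p v t ∈ Msph n := by
  intro i
  have hpos : 0 < 1 + t ^ 2 * ∑ j, v (i, j) ^ 2 := by positivity
  have h : ∑ j, (p (i, j) + t * v (i, j)) ^ 2 = 1 + t ^ 2 * ∑ j, v (i, j) ^ 2 := by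
    have h2 : ∑ j, (p (i, j) + t * v (i, j)) ^ 2 = ∑ j, p (i, j) ^ 2 +
        2 * t * ∑ j, p (i, j) * v (i, j) + t ^ 2 * ∑ j, v (i, j) ^ 2 := by
      simp only [Finset.mul_sum, ← Finset.sum_add_distrib]
      exact Finset.sum_congr rfl fun j _ => by ring
    rw [h2, hp i, hv i]
    ring
  simp only [sphereCurve_apply, div_pow, Real.sq_sqrt hpos.le]
  rw [← Finset.sum_div, h, div_self hpos.ne']

theorem hasDerivAt_sphereCurve (p v : E4 n) : HasDerivAt (sphereCurve p v) v 0 := by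
  rw [hasDerivAt_iff_hasFDerivAt, ← hasFDerivWithinAt_univ, hasFDerivWithinAt_euclidean]
  intro ij
  rw [hasFDerivWithinAt_univ]
  have hnum : HasDerivAt (fun t : ℝ => p ij + t * v ij) (v ij) 0 := by
    simpa using ((hasDerivAt_id (0 : ℝ)).mul_const (v ij)).const_add (p ij)
  have hden : HasDerivAt (fun t : ℝ => Real.sqrt (1 + t ^ 2 * ∑ j, v (ij.1, j) ^ 2)) 0 0 := by
    have h := (((hasDerivAt_pow 2 (0 : ℝ)).mul_const (∑ j, v (ij.1, j) ^ 2)).const_add 1).sqrt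
      (by simp)
    simpa using h
  have h := hnum.div hden (by simp)
  refine h.hasFDerivAt.congr_fderiv ?_
  ext
  simp

/-- First-order optimality on the product of spheres: the projected gradient vanishes at a
minimizer. -/
theorem projM_eq_zero_of_forall_le {u : E4 n → ℝ} {a p : E4 n} (hp : p ∈ Msph n)
    (hu : HasGradientAt u a p) (h : ∀ y ∈ Msph n, u p ≤ u y) : projM p a = 0 := by
  have hc := hasDerivAt_sphereCurve p (projM p a)
  have hu' : HasFDerivAt u (InnerProductSpace.toDual ℝ _ a) (sphereCurve p (projM p a) 0) := by
    rw [sphereCurve_zero]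
    exact hu.hasFDerivAt
  have hd := hu'.comp_hasDerivAt 0 hc
  have hmin : IsLocalMin (u ∘ sphereCurve p (projM p a)) 0 :=
    Filter.Eventually.of_forall fun t => by
      simpa only [Function.comp_apply, sphereCurve_zero] using
        h _ (sphereCurve_mem hp (sum_mul_projM hp a) t)
  have h0 := hmin.hasDerivAt_eq_zero hd
  rw [InnerProductSpace.toDual_apply_apply, inner_projM hp] at h0
  simpa using h0

end SphereProduct

section AugmentedLagrangian

variable {n : ℕ} {f : E4 n → E4 n → E3 n → E3 n → ℝ} {g : E4 n → E4 n → ℝ}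

theorem hasGradientAt_augL_fst
    (hf : ContDiff ℝ 1 fun p : (E4 n × E4 n) × E3 n × E3 n => f p.1.1 p.1.2 p.2.1 p.2.2)
    (hg : ContDiff ℝ 1 fun p : E4 n × E4 n => g p.1 p.2) (β : ℝ)
    (a b : E4 n) (c d : E3 n) (l : E4 n) (m : E3 n) :
    HasGradientAt (fun y => augL f g β y b c d l m)
      (grad1f f a b c d + grad1g g a b - l + β • (a - b)) a := by
  have h1 : DifferentiableAt ℝ (fun y => f y b c d) a :=
    (hf.differentiable one_ne_zero).comp
      (g := fun p : (E4 n × E4 n) × E3 n × E3 n => f p.1.1 p.1.2 p.2.1 p.2.2)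
      (f := fun y : E4 n => ((y, b), c, d)) (by fun_prop) a
  have h2 : DifferentiableAt ℝ (fun y => g y b) a :=
    (hg.differentiable one_ne_zero).comp (g := fun p : E4 n × E4 n => g p.1 p.2)
      (f := fun y : E4 n => (y, b)) (by fun_prop) a
  have h := (((h1.hasGradientAt.fun_add h2.hasGradientAt).fun_sub
    (hasGradientAt_inner_sub_right l b a)).fun_sub_const ⟪m, c - d⟫).fun_add
    (((hasGradientAt_norm_sub_sq b a).fun_add_const (‖c - d‖ ^ 2)).fun_const_mul (β / 2))
  rw [smul_smul, div_mul_cancel₀ _ two_ne_zero] at h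
  exact h

theorem hasGradientAt_augL_snd
    (hf : ContDiff ℝ 1 fun p : (E4 n × E4 n) × E3 n × E3 n => f p.1.1 p.1.2 p.2.1 p.2.2)
    (hg : ContDiff ℝ 1 fun p : E4 n × E4 n => g p.1 p.2) (β : ℝ)
    (a b : E4 n) (c d : E3 n) (l : E4 n) (m : E3 n) :
    HasGradientAt (fun y => augL f g β a y c d l m)
      (grad2f f a b c d + grad2g g a b + l + β • (b - a)) b := by
  have h1 : DifferentiableAt ℝ (fun y => f a y c d) b :=
    (hf.differentiable one_ne_zero).comp
      (g := fun p : (E4 n × E4 n) × E3 n × E3 n => f p.1.1 p.1.2 p.2.1 p.2.2)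
      (f := fun y : E4 n => ((a, y), c, d)) (by fun_prop) b
  have h2 : DifferentiableAt ℝ (fun y => g a y) b :=
    (hg.differentiable one_ne_zero).comp (g := fun p : E4 n × E4 n => g p.1 p.2)
      (f := fun y : E4 n => (a, y)) (by fun_prop) b
  have h := (((h1.hasGradientAt.fun_add h2.hasGradientAt).fun_sub
    (hasGradientAt_inner_const_sub_right l a b)).fun_sub_const ⟪m, c - d⟫).fun_add
    (((hasGradientAt_norm_const_sub_sq a b).fun_add_const (‖c - d‖ ^ 2)).fun_const_mul (β / 2))
  rw [smul_smul, div_mul_cancel₀ _ two_ne_zero, sub_neg_eq_add] at h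
  exact h

theorem hasGradientAt_augL_trd
    (hf : ContDiff ℝ 1 fun p : (E4 n × E4 n) × E3 n × E3 n => f p.1.1 p.1.2 p.2.1 p.2.2) (β : ℝ)
    (a b : E4 n) (c d : E3 n) (l : E4 n) (m : E3 n) :
    HasGradientAt (fun y => augL f g β a b y d l m)
      (grad3f f a b c d - m + β • (c - d)) c := by
  have h1 : DifferentiableAt ℝ (fun y => f a b y d) c :=
    (hf.differentiable one_ne_zero).comp
      (g := fun p : (E4 n × E4 n) × E3 n × E3 n => f p.1.1 p.1.2 p.2.1 p.2.2)
      (f := fun y : E3 n => ((a, b), y, d)) (by fun_prop) c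
  have h := (((h1.hasGradientAt.fun_add_const (g a b)).fun_sub_const ⟪l, a - b⟫).fun_sub
    (hasGradientAt_inner_sub_right m d c)).fun_add
    (((hasGradientAt_norm_sub_sq d c).fun_const_add (‖a - b‖ ^ 2)).fun_const_mul (β / 2))
  rw [smul_smul, div_mul_cancel₀ _ two_ne_zero] at h
  exact h

theorem hasGradientAt_augL_fth
    (hf : ContDiff ℝ 1 fun p : (E4 n × E4 n) × E3 n × E3 n => f p.1.1 p.1.2 p.2.1 p.2.2) (β : ℝ)
    (a b : E4 n) (c d : E3 n) (l : E4 n) (m : E3 n) :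
    HasGradientAt (fun y => augL f g β a b c y l m)
      (grad4f f a b c d + m + β • (d - c)) d := by
  have h1 : DifferentiableAt ℝ (fun y => f a b c y) d :=
    (hf.differentiable one_ne_zero).comp
      (g := fun p : (E4 n × E4 n) × E3 n × E3 n => f p.1.1 p.1.2 p.2.1 p.2.2)
      (f := fun y : E3 n => ((a, b), c, y)) (by fun_prop) d
  have h := (((h1.hasGradientAt.fun_add_const (g a b)).fun_sub_const ⟪l, a - b⟫).fun_sub
    (hasGradientAt_inner_const_sub_right m c d)).fun_add
    (((hasGradientAt_norm_const_sub_sq c d).fun_const_add (‖a - b‖ ^ 2)).fun_const_mul (β / 2))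
  rw [smul_smul, div_mul_cancel₀ _ two_ne_zero, sub_neg_eq_add] at h
  exact h

theorem hasGradientAt_augL_multiplier_fst (β : ℝ)
    (a b : E4 n) (c d : E3 n) (l : E4 n) (m : E3 n) :
    HasGradientAt (fun y => augL f g β a b c d y m) (-(a - b)) l :=
  (((hasGradientAt_inner_left (a - b) l).fun_const_sub _).fun_sub_const _).fun_add_const _

theorem hasGradientAt_augL_multiplier_snd (β : ℝ)
    (a b : E4 n) (c d : E3 n) (l : E4 n) (m : E3 n) :
    HasGradientAt (fun y => augL f g β a b c d l y) (-(c - d)) m :=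
  ((hasGradientAt_inner_left (c - d) m).fun_const_sub _).fun_add_const _

end AugmentedLagrangian

section Lyapunov

variable {n : ℕ} {f : E4 n → E4 n → E3 n → E3 n → ℝ} {g : E4 n → E4 n → ℝ}
  (β α1 τ : ℝ) (M1 M2 : Matrix (Fin n × Fin 4) (Fin n × Fin 4) ℝ)
  (M3 M4 : Matrix (Fin n × Fin 3) (Fin n × Fin 3) ℝ)
  (x1 x2 : E4 n) (x3 x4 : E3 n) (y1 y2 : E4 n) (y3 y4 : E3 n)
  (l1 : E4 n) (l2 : E3 n) (m1 : E4 n) (m2 : E3 n)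

theorem gradient_Psi_fst
    (hf : ContDiff ℝ 1 fun p : (E4 n × E4 n) × E3 n × E3 n => f p.1.1 p.1.2 p.2.1 p.2.2)
    (hg : ContDiff ℝ 1 fun p : E4 n × E4 n => g p.1 p.2) :
    gradient (fun z => Psi f g β α1 τ M1 M2 M3 M4 z x2 x3 x4 y1 y2 y3 y4 l1 l2 m1 m2) x1 =
      (grad1f f x1 x2 x3 x4 + grad1g g x1 x2 - l1 + β • (x1 - x2)) + qfGrad M1 (x1 - y1) :=
  (((hasGradientAt_augL_fst hf hg β x1 x2 x3 x4 l1 l2).fun_add_const _).fun_add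
    ((((hasGradientAt_qf_sub M1 y1 x1).fun_add_const _).fun_add_const _).fun_add_const _)).gradient

theorem gradient_Psi_snd
    (hf : ContDiff ℝ 1 fun p : (E4 n × E4 n) × E3 n × E3 n => f p.1.1 p.1.2 p.2.1 p.2.2)
    (hg : ContDiff ℝ 1 fun p : E4 n × E4 n => g p.1 p.2) :
    gradient (fun z => Psi f g β α1 τ M1 M2 M3 M4 x1 z x3 x4 y1 y2 y3 y4 l1 l2 m1 m2) x2 =
      (grad2f f x1 x2 x3 x4 + grad2g g x1 x2 + l1 + β • (x2 - x1)) + qfGrad M2 (x2 - y2) :=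
  (((hasGradientAt_augL_snd hf hg β x1 x2 x3 x4 l1 l2).fun_add_const _).fun_add
    ((((hasGradientAt_qf_sub M2 y2 x2).fun_const_add _).fun_add_const _).fun_add_const _)).gradient

theorem gradient_Psi_trd
    (hf : ContDiff ℝ 1 fun p : (E4 n × E4 n) × E3 n × E3 n => f p.1.1 p.1.2 p.2.1 p.2.2) :
    gradient (fun z => Psi f g β α1 τ M1 M2 M3 M4 x1 x2 z x4 y1 y2 y3 y4 l1 l2 m1 m2) x3 =
      (grad3f f x1 x2 x3 x4 - l2 + β • (x3 - x4)) + qfGrad M3 (x3 - y3) :=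
  (((hasGradientAt_augL_trd hf β x1 x2 x3 x4 l1 l2).fun_add_const _).fun_add
    (((hasGradientAt_qf_sub M3 y3 x3).fun_const_add _).fun_add_const _)).gradient

theorem gradient_Psi_fth
    (hf : ContDiff ℝ 1 fun p : (E4 n × E4 n) × E3 n × E3 n => f p.1.1 p.1.2 p.2.1 p.2.2) :
    gradient (fun z => Psi f g β α1 τ M1 M2 M3 M4 x1 x2 x3 z y1 y2 y3 y4 l1 l2 m1 m2) x4 =
      (grad4f f x1 x2 x3 x4 + l2 + β • (x4 - x3)) + qfGrad M4 (x4 - y4) :=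
  (((hasGradientAt_augL_fth hf β x1 x2 x3 x4 l1 l2).fun_add_const _).fun_add
    ((hasGradientAt_qf_sub M4 y4 x4).fun_const_add _)).gradient

theorem gradient_Psi_prev_fst :
    gradient (fun z => Psi f g β α1 τ M1 M2 M3 M4 x1 x2 x3 x4 z y2 y3 y4 l1 l2 m1 m2) y1 =
      qfGrad M1 (y1 - x1) :=
  (((((hasGradientAt_qf_const_sub M1 x1 y1).fun_add_const _).fun_add_const _).fun_add_const _).fun_const_add _).gradient

theorem gradient_Psi_prev_snd :
    gradient (fun z => Psi f g β α1 τ M1 M2 M3 M4 x1 x2 x3 x4 y1 z y3 y4 l1 l2 m1 m2) y2 =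
      qfGrad M2 (y2 - x2) :=
  (((((hasGradientAt_qf_const_sub M2 x2 y2).fun_const_add _).fun_add_const _).fun_add_const _).fun_const_add _).gradient

theorem gradient_Psi_prev_trd :
    gradient (fun z => Psi f g β α1 τ M1 M2 M3 M4 x1 x2 x3 x4 y1 y2 z y4 l1 l2 m1 m2) y3 =
      qfGrad M3 (y3 - x3) :=
  ((((hasGradientAt_qf_const_sub M3 x3 y3).fun_const_add _).fun_add_const _).fun_const_add _).gradient

theorem gradient_Psi_prev_fth :
    gradient (fun z => Psi f g β α1 τ M1 M2 M3 M4 x1 x2 x3 x4 y1 y2 y3 z l1 l2 m1 m2) y4 =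
      qfGrad M4 (y4 - x4) :=
  (((hasGradientAt_qf_const_sub M4 x4 y4).fun_const_add _).fun_const_add _).gradient

theorem gradient_Psi_multiplier_fst :
    gradient (fun z => Psi f g β α1 τ M1 M2 M3 M4 x1 x2 x3 x4 y1 y2 y3 y4 z l2 m1 m2) l1 =
      -(x1 - x2) + (α1 / (τ * β)) • (2 : ℝ) • (l1 - m1) :=
  (((hasGradientAt_augL_multiplier_fst β x1 x2 x3 x4 l1 l2).fun_add
    (((hasGradientAt_norm_sub_sq m1 l1).fun_add_const _).fun_const_mul _)).fun_add_const _).gradient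

theorem gradient_Psi_multiplier_snd :
    gradient (fun z => Psi f g β α1 τ M1 M2 M3 M4 x1 x2 x3 x4 y1 y2 y3 y4 l1 z m1 m2) l2 =
      -(x3 - x4) + (α1 / (τ * β)) • (2 : ℝ) • (l2 - m2) :=
  (((hasGradientAt_augL_multiplier_snd β x1 x2 x3 x4 l1 l2).fun_add
    (((hasGradientAt_norm_sub_sq m2 l2).fun_const_add _).fun_const_mul _)).fun_add_const _).gradient

theorem gradient_Psi_prev_multiplier_fst :
    gradient (fun z => Psi f g β α1 τ M1 M2 M3 M4 x1 x2 x3 x4 y1 y2 y3 y4 l1 l2 z m2) m1 =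
      (α1 / (τ * β)) • (2 : ℝ) • (m1 - l1) :=
  (((((hasGradientAt_norm_const_sub_sq l1 m1).fun_add_const _).fun_const_mul _).fun_const_add _).fun_add_const
    _).gradient

theorem gradient_Psi_prev_multiplier_snd :
    gradient (fun z => Psi f g β α1 τ M1 M2 M3 M4 x1 x2 x3 x4 y1 y2 y3 y4 l1 l2 m1 z) m2 =
      (α1 / (τ * β)) • (2 : ℝ) • (m2 - l2) :=
  (((((hasGradientAt_norm_const_sub_sq l2 m2).fun_const_add _).fun_const_mul _).fun_const_add _).fun_add_const
    _).gradient

end Lyapunov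

section Estimates

theorem sqrt_add_sq_le {s a B b : ℝ} (hs : Real.sqrt s ≤ B) (ha : 0 ≤ a) (hab : a ≤ b) :
    Real.sqrt (s + a ^ 2) ≤ B + b := by
  rw [Real.sqrt_le_iff] at hs ⊢
  constructor
  · linarith [hs.1]
  · nlinarith [hs.1, hs.2, mul_nonneg hs.1 (ha.trans hab)]

theorem le_sqrt_sum_four (a b c d : ℝ) :
    a ≤ Real.sqrt (a ^ 2 + b ^ 2 + c ^ 2 + d ^ 2) ∧
    b ≤ Real.sqrt (a ^ 2 + b ^ 2 + c ^ 2 + d ^ 2) ∧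
    c ≤ Real.sqrt (a ^ 2 + b ^ 2 + c ^ 2 + d ^ 2) ∧
    d ≤ Real.sqrt (a ^ 2 + b ^ 2 + c ^ 2 + d ^ 2) := by
  refine ⟨?_, ?_, ?_, ?_⟩ <;> apply Real.le_sqrt_of_sq_le <;>
    linarith [sq_nonneg a, sq_nonneg b, sq_nonneg c, sq_nonneg d]

theorem le_sqrt_sum_two (a b : ℝ) :
    a ≤ Real.sqrt (a ^ 2 + b ^ 2) ∧ b ≤ Real.sqrt (a ^ 2 + b ^ 2) := by
  refine ⟨?_, ?_⟩ <;> apply Real.le_sqrt_of_sq_le <;> linarith [sq_nonneg a, sq_nonneg b]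

theorem norm_sub_add_smul_le {F : Type*} [NormedAddCommGroup F] [NormedSpace ℝ F] {β : ℝ}
    {G G' : F} (hβ : 0 ≤ β) (l l' p q q' : F) :
    ‖G' - l' + β • (p - q') - (G - l + β • (p - q))‖ ≤
      ‖G' - G‖ + ‖l' - l‖ + β * ‖q' - q‖ := by
  have e : G' - l' + β • (p - q') - (G - l + β • (p - q)) =
      (G' - G) - (l' - l) - β • (q' - q) := by
    simp only [smul_sub]
    abel
  have h1 := norm_sub_le ((G' - G) - (l' - l)) (β • (q' - q))
  have h2 := norm_sub_le (G' - G) (l' - l)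
  rw [norm_smul, Real.norm_of_nonneg hβ] at h1
  rw [e]
  linarith

variable {ι : Type*} [Fintype ι] [DecidableEq ι]

/-- If `p` satisfies the optimality condition of a proximal step, the gradient after the update
is controlled by the gradient change and the step length. -/
theorem norm_sub_prox_le (M H : Matrix ι ι ℝ) (G G' s : EuclideanSpace ℝ ι) :
    ‖G' + qfGrad M s - (G + (1 / 2 : ℝ) • qfGrad H s)‖ ≤
      ‖G' - G‖ + (‖qfGrad M‖ + ‖qfGrad H‖) * ‖s‖ := by
  have e : G' + qfGrad M s - (G + (1 / 2 : ℝ) • qfGrad H s) =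
      (G' - G) + (qfGrad M s - (1 / 2 : ℝ) • qfGrad H s) := by abel
  have h1 := norm_add_le (G' - G) (qfGrad M s - (1 / 2 : ℝ) • qfGrad H s)
  have h2 := norm_sub_le (qfGrad M s) ((1 / 2 : ℝ) • qfGrad H s)
  have h3 := (qfGrad M).le_opNorm s
  have h4 := (qfGrad H).le_opNorm s
  rw [norm_smul, Real.norm_of_nonneg (by norm_num : (0 : ℝ) ≤ 1 / 2)] at h2
  rw [e]
  linarith [norm_nonneg (qfGrad H s)]

end Estimates

/-- Lemma 5.6 (bound on the Riemannian gradient of the Lyapunov function): if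
`β > max{β′, β″}`, there exist `ϱ₁, ϱ₂, ϱ₃ > 0` such that for all `k ≥ 1`,
`‖grad Ψ(x^{k+1}, x^k, λ^{k+1}, λ^k)‖ ≤ ϱ₁‖Δx^{k+1}‖ + ϱ₂‖Δx^k‖ + ϱ₃‖Δλ^{k+1}‖`. -/
theorem stmt19 (n : ℕ)
    (f : E4 n → E4 n → E3 n → E3 n → ℝ) (g : E4 n → E4 n → ℝ)
    (hf : ContDiff ℝ 1 fun p : (E4 n × E4 n) × E3 n × E3 n => f p.1.1 p.1.2 p.2.1 p.2.2)
    (hg : ContDiff ℝ 1 fun p : E4 n × E4 n => g p.1 p.2)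
    (Lf Lg : ℝ) (hLf : 0 < Lf) (hLg : 0 < Lg)
    (hfLip : ∀ a b : E4 n, ∀ c d : E3 n, ∀ a' b' : E4 n, ∀ c' d' : E3 n,
        Real.sqrt (‖grad1f f a b c d - grad1f f a' b' c' d'‖ ^ 2 +
            ‖grad2f f a b c d - grad2f f a' b' c' d'‖ ^ 2 +
            ‖grad3f f a b c d - grad3f f a' b' c' d'‖ ^ 2 +
            ‖grad4f f a b c d - grad4f f a' b' c' d'‖ ^ 2) ≤
          Lf * Real.sqrt (‖a - a'‖ ^ 2 + ‖b - b'‖ ^ 2 + ‖c - c'‖ ^ 2 + ‖d - d'‖ ^ 2))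
    (hgLip : ∀ a b a' b' : E4 n,
        Real.sqrt (‖grad1g g a b - grad1g g a' b'‖ ^ 2 +
            ‖grad2g g a b - grad2g g a' b'‖ ^ 2) ≤
          Lg * Real.sqrt (‖a - a'‖ ^ 2 + ‖b - b'‖ ^ 2))
    (hfconv1 : ∀ (b : E4 n) (c d : E3 n), ConvexOn ℝ Set.univ fun y => f y b c d)
    (hfconv2 : ∀ (a : E4 n) (c d : E3 n), ConvexOn ℝ Set.univ fun y => f a y c d)
    (hfconv3 : ∀ (a b : E4 n) (d : E3 n), ConvexOn ℝ Set.univ fun y => f a b y d)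
    (hfconv4 : ∀ (a b : E4 n) (c : E3 n), ConvexOn ℝ Set.univ fun y => f a b c y)
    (hgconv1 : ∀ b : E4 n, ConvexOn ℝ Set.univ fun y => g y b)
    (hgconv2 : ∀ a : E4 n, ConvexOn ℝ Set.univ fun y => g a y)
    (β τ : ℝ) (hβ : 0 < β) (hτ : τ ∈ Set.Ioo (0 : ℝ) 2)
    (H1 H2 : Matrix (Fin n × Fin 4) (Fin n × Fin 4) ℝ)
    (H3 H4 : Matrix (Fin n × Fin 3) (Fin n × Fin 3) ℝ)
    (hH1 : H1.PosDef) (hH2 : H2.PosDef) (hH3 : H3.PosDef) (hH4 : H4.PosDef)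
    (x1 x2 : ℕ → E4 n) (x3 x4 : ℕ → E3 n)
    (l1 : ℕ → E4 n) (l2 : ℕ → E3 n)
    (hbdd : ∃ R : ℝ, ∀ k, ‖x1 k‖ ≤ R ∧ ‖x2 k‖ ≤ R ∧ ‖x3 k‖ ≤ R ∧ ‖x4 k‖ ≤ R ∧
        ‖l1 k‖ ≤ R ∧ ‖l2 k‖ ≤ R)
    (hx1M : ∀ k, x1 k ∈ Msph n)
    (hmin1 : ∀ k, ∀ y ∈ Msph n,
        augL f g β (x1 (k + 1)) (x2 k) (x3 k) (x4 k) (l1 k) (l2 k) +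
            1 / 2 * qf H1 (x1 (k + 1) - x1 k) ≤
          augL f g β y (x2 k) (x3 k) (x4 k) (l1 k) (l2 k) + 1 / 2 * qf H1 (y - x1 k))
    (hmin2 : ∀ k, ∀ y : E4 n,
        augL f g β (x1 (k + 1)) (x2 (k + 1)) (x3 k) (x4 k) (l1 k) (l2 k) +
            1 / 2 * qf H2 (x2 (k + 1) - x2 k) ≤
          augL f g β (x1 (k + 1)) y (x3 k) (x4 k) (l1 k) (l2 k) + 1 / 2 * qf H2 (y - x2 k))
    (hmin3 : ∀ k, ∀ y : E3 n,
        augL f g β (x1 (k + 1)) (x2 (k + 1)) (x3 (k + 1)) (x4 k) (l1 k) (l2 k) +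
            1 / 2 * qf H3 (x3 (k + 1) - x3 k) ≤
          augL f g β (x1 (k + 1)) (x2 (k + 1)) y (x4 k) (l1 k) (l2 k) +
            1 / 2 * qf H3 (y - x3 k))
    (hmin4 : ∀ k, ∀ y : E3 n,
        augL f g β (x1 (k + 1)) (x2 (k + 1)) (x3 (k + 1)) (x4 (k + 1)) (l1 k) (l2 k) +
            1 / 2 * qf H4 (x4 (k + 1) - x4 k) ≤
          augL f g β (x1 (k + 1)) (x2 (k + 1)) (x3 (k + 1)) y (l1 k) (l2 k) +
            1 / 2 * qf H4 (y - x4 k))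
    (hdual1 : ∀ k, l1 (k + 1) = l1 k - (τ * β) • (x1 (k + 1) - x2 (k + 1)))
    (hdual2 : ∀ k, l2 (k + 1) = l2 k - (τ * β) • (x3 (k + 1) - x4 (k + 1)))
    (α1 α2 : ℝ)
    (hα1 : α1 = |1 - τ| / (1 - |1 - τ|))
    (hα2 : α2 = τ / (1 - |1 - τ|) ^ 2)
    (Lg2 : ℝ) (hLg2 : 0 < Lg2)
    (hg2Lip : ∀ a b b' : E4 n, ‖grad2g g a b - grad2g g a b'‖ ≤ Lg2 * ‖b - b'‖)
    (fstar gstar : ℝ)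
    (hfstar : IsGLB {r : ℝ | ∃ y1 ∈ Msph n, ∃ (y2 : E4 n) (y3 y4 : E3 n),
        r = f y1 y2 y3 y4} fstar)
    (hgstar : IsGLB {r : ℝ | ∃ y1 ∈ Msph n, ∃ y2 : E4 n, r = g y1 y2} gstar)
    (k1lo k2lo k2hi k3lo k4lo k4hi : ℝ)
    (hk1lo : IsLeast {μ : ℝ | ∃ v : (Fin n × Fin 4) → ℝ, v ≠ 0 ∧ H1 *ᵥ v = μ • v} k1lo)
    (hk2lo : IsLeast {μ : ℝ | ∃ v : (Fin n × Fin 4) → ℝ, v ≠ 0 ∧ H2 *ᵥ v = μ • v} k2lo)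
    (hk2hi : IsGreatest {μ : ℝ | ∃ v : (Fin n × Fin 4) → ℝ, v ≠ 0 ∧ H2 *ᵥ v = μ • v} k2hi)
    (hk3lo : IsLeast {μ : ℝ | ∃ v : (Fin n × Fin 3) → ℝ, v ≠ 0 ∧ H3 *ᵥ v = μ • v} k3lo)
    (hk4lo : IsLeast {μ : ℝ | ∃ v : (Fin n × Fin 3) → ℝ, v ≠ 0 ∧ H4 *ᵥ v = μ • v} k4lo)
    (hk4hi : IsGreatest {μ : ℝ | ∃ v : (Fin n × Fin 3) → ℝ, v ≠ 0 ∧ H4 *ᵥ v = μ • v} k4hi)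
    (βone : ℝ)
    (hβone : βone = max (2 * (Lf + Lg2)) (max (2 * α2 / k1lo * (7 * Lf ^ 2 + 4 * Lg ^ 2))
        (max (α2 / k2lo * (7 * Lf ^ 2 + 4 * Lg ^ 2) + (4 * α2 + 2) * k2hi ^ 2 / k2lo)
          (max ((3 * α2 + 2) / k3lo * Lf ^ 2)
            ((3 * α2 + 2) / k4lo * Lf ^ 2 + (3 * α2 + 1) * k4hi ^ 2 / k4lo)))))
    (βtwo : ℝ)
    (hβtwo : βtwo = max (2 * α2 / k1lo * (7 * Lf ^ 2 + 4 * Lg ^ 2))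
        (max (α2 / k2lo * (7 * Lf ^ 2 + 4 * Lg ^ 2 + 8 * k2hi ^ 2))
          (max (7 * α2 * Lf ^ 2 / k3lo) (α2 / k4lo * (7 * Lf ^ 2 + 6 * k4hi ^ 2)))))
    (hβgt : β > max βone βtwo)
    (M1 M2 : Matrix (Fin n × Fin 4) (Fin n × Fin 4) ℝ)
    (M3 M4 : Matrix (Fin n × Fin 3) (Fin n × Fin 3) ℝ)
    (hM1 : M1 = (1 / 2 : ℝ) • H1 - (α2 / β * (7 * Lf ^ 2 + 4 * Lg ^ 2)) • 1)
    (hM2 : M2 = H2 - (α2 / β) • ((7 * Lf ^ 2 + 4 * Lg ^ 2) • 1 + (4 : ℝ) • (H2ᵀ * H2)))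
    (hM3 : M3 = H3 - (3 * α2 / β * Lf ^ 2) • 1)
    (hM4 : M4 = H4 - (α2 / β) • ((3 * Lf ^ 2) • 1 + (3 : ℝ) • (H4ᵀ * H4)))
    :
    ∃ r1 r2 r3 : ℝ, 0 < r1 ∧ 0 < r2 ∧ 0 < r3 ∧
      ∀ k, 1 ≤ k →
        Real.sqrt (‖projM (x1 (k + 1)) (gradient (fun y => Psi f g β α1 τ M1 M2 M3 M4 y (x2 (k + 1)) (x3 (k + 1)) (x4 (k + 1)) (x1 k) (x2 k) (x3 k) (x4 k) (l1 (k + 1)) (l2 (k + 1)) (l1 k) (l2 k)) (x1 (k + 1)))‖ ^ 2 +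
            ‖(gradient (fun y => Psi f g β α1 τ M1 M2 M3 M4 (x1 (k + 1)) y (x3 (k + 1)) (x4 (k + 1)) (x1 k) (x2 k) (x3 k) (x4 k) (l1 (k + 1)) (l2 (k + 1)) (l1 k) (l2 k)) (x2 (k + 1)))‖ ^ 2 +
            ‖(gradient (fun y => Psi f g β α1 τ M1 M2 M3 M4 (x1 (k + 1)) (x2 (k + 1)) y (x4 (k + 1)) (x1 k) (x2 k) (x3 k) (x4 k) (l1 (k + 1)) (l2 (k + 1)) (l1 k) (l2 k)) (x3 (k + 1)))‖ ^ 2 +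
            ‖(gradient (fun y => Psi f g β α1 τ M1 M2 M3 M4 (x1 (k + 1)) (x2 (k + 1)) (x3 (k + 1)) y (x1 k) (x2 k) (x3 k) (x4 k) (l1 (k + 1)) (l2 (k + 1)) (l1 k) (l2 k)) (x4 (k + 1)))‖ ^ 2 +
            ‖projM (x1 k) (gradient (fun y => Psi f g β α1 τ M1 M2 M3 M4 (x1 (k + 1)) (x2 (k + 1)) (x3 (k + 1)) (x4 (k + 1)) y (x2 k) (x3 k) (x4 k) (l1 (k + 1)) (l2 (k + 1)) (l1 k) (l2 k)) (x1 k))‖ ^ 2 +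
            ‖(gradient (fun y => Psi f g β α1 τ M1 M2 M3 M4 (x1 (k + 1)) (x2 (k + 1)) (x3 (k + 1)) (x4 (k + 1)) (x1 k) y (x3 k) (x4 k) (l1 (k + 1)) (l2 (k + 1)) (l1 k) (l2 k)) (x2 k))‖ ^ 2 +
            ‖(gradient (fun y => Psi f g β α1 τ M1 M2 M3 M4 (x1 (k + 1)) (x2 (k + 1)) (x3 (k + 1)) (x4 (k + 1)) (x1 k) (x2 k) y (x4 k) (l1 (k + 1)) (l2 (k + 1)) (l1 k) (l2 k)) (x3 k))‖ ^ 2 +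
            ‖(gradient (fun y => Psi f g β α1 τ M1 M2 M3 M4 (x1 (k + 1)) (x2 (k + 1)) (x3 (k + 1)) (x4 (k + 1)) (x1 k) (x2 k) (x3 k) y (l1 (k + 1)) (l2 (k + 1)) (l1 k) (l2 k)) (x4 k))‖ ^ 2 +
            ‖(gradient (fun y => Psi f g β α1 τ M1 M2 M3 M4 (x1 (k + 1)) (x2 (k + 1)) (x3 (k + 1)) (x4 (k + 1)) (x1 k) (x2 k) (x3 k) (x4 k) y (l2 (k + 1)) (l1 k) (l2 k)) (l1 (k + 1)))‖ ^ 2 +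
            ‖(gradient (fun y => Psi f g β α1 τ M1 M2 M3 M4 (x1 (k + 1)) (x2 (k + 1)) (x3 (k + 1)) (x4 (k + 1)) (x1 k) (x2 k) (x3 k) (x4 k) (l1 (k + 1)) y (l1 k) (l2 k)) (l2 (k + 1)))‖ ^ 2 +
            ‖(gradient (fun y => Psi f g β α1 τ M1 M2 M3 M4 (x1 (k + 1)) (x2 (k + 1)) (x3 (k + 1)) (x4 (k + 1)) (x1 k) (x2 k) (x3 k) (x4 k) (l1 (k + 1)) (l2 (k + 1)) y (l2 k)) (l1 k))‖ ^ 2 +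
            ‖(gradient (fun y => Psi f g β α1 τ M1 M2 M3 M4 (x1 (k + 1)) (x2 (k + 1)) (x3 (k + 1)) (x4 (k + 1)) (x1 k) (x2 k) (x3 k) (x4 k) (l1 (k + 1)) (l2 (k + 1)) (l1 k) y) (l2 k))‖ ^ 2) ≤
          r1 * Real.sqrt (‖x1 (k + 1) - x1 k‖ ^ 2 + ‖x2 (k + 1) - x2 k‖ ^ 2 +
              ‖x3 (k + 1) - x3 k‖ ^ 2 + ‖x4 (k + 1) - x4 k‖ ^ 2) +
            r2 * Real.sqrt (‖x1 k - x1 (k - 1)‖ ^ 2 + ‖x2 k - x2 (k - 1)‖ ^ 2 +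
              ‖x3 k - x3 (k - 1)‖ ^ 2 + ‖x4 k - x4 (k - 1)‖ ^ 2) +
            r3 * Real.sqrt (‖l1 (k + 1) - l1 k‖ ^ 2 + ‖l2 (k + 1) - l2 k‖ ^ 2) := by
  have hτ0 : 0 < τ := hτ.1
  have hτβ : 0 < τ * β := mul_pos hτ0 hβ
  set S : ℝ :=
    (Lf + Lg + β + 1 + (‖qfGrad M1‖ + ‖qfGrad H1‖)) +
    (Lf + 1 + (‖qfGrad M2‖ + ‖qfGrad H2‖)) +
    (Lf + β + 1 + (‖qfGrad M3‖ + ‖qfGrad H3‖)) +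
    (1 + (‖qfGrad M4‖ + ‖qfGrad H4‖)) +
    ‖qfGrad M1‖ + ‖qfGrad M2‖ + ‖qfGrad M3‖ + ‖qfGrad M4‖ +
    ((τ * β)⁻¹ + |α1 / (τ * β)| * 2) + ((τ * β)⁻¹ + |α1 / (τ * β)| * 2) +
    |α1 / (τ * β)| * 2 + |α1 / (τ * β)| * 2 with hS
  have hS0 : 0 ≤ S := by positivity
  refine ⟨S + 1, 1, S + 1, by positivity, one_pos, by positivity, fun k _ => ?_⟩
  rw [gradient_Psi_fst (hf := hf) (hg := hg), gradient_Psi_snd (hf := hf) (hg := hg),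
    gradient_Psi_trd (hf := hf), gradient_Psi_fth (hf := hf), gradient_Psi_prev_fst,
    gradient_Psi_prev_snd, gradient_Psi_prev_trd, gradient_Psi_prev_fth,
    gradient_Psi_multiplier_fst, gradient_Psi_multiplier_snd, gradient_Psi_prev_multiplier_fst,
    gradient_Psi_prev_multiplier_snd]
  have opt1 : projM (x1 (k + 1)) _ = 0 := projM_eq_zero_of_forall_le (hx1M (k + 1))
    ((hasGradientAt_augL_fst hf hg β (x1 (k + 1)) (x2 k) (x3 k) (x4 k) (l1 k) (l2 k)).fun_add
      ((hasGradientAt_qf_sub H1 (x1 k) (x1 (k + 1))).fun_const_mul (1 / 2))) (hmin1 k)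
  have opt2 := ((hasGradientAt_augL_snd hf hg β (x1 (k + 1)) (x2 (k + 1)) (x3 k) (x4 k)
    (l1 k) (l2 k)).fun_add ((hasGradientAt_qf_sub H2 (x2 k) (x2 (k + 1))).fun_const_mul
      (1 / 2))).eq_zero_of_forall_le (hmin2 k)
  have opt3 := ((hasGradientAt_augL_trd (g := g) hf β (x1 (k + 1)) (x2 (k + 1)) (x3 (k + 1)) (x4 k)
    (l1 k) (l2 k)).fun_add ((hasGradientAt_qf_sub H3 (x3 k) (x3 (k + 1))).fun_const_mul
      (1 / 2))).eq_zero_of_forall_le (hmin3 k)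
  have opt4 := ((hasGradientAt_augL_fth (g := g) hf β (x1 (k + 1)) (x2 (k + 1)) (x3 (k + 1))
    (x4 (k + 1)) (l1 k) (l2 k)).fun_add ((hasGradientAt_qf_sub H4 (x4 k)
      (x4 (k + 1))).fun_const_mul (1 / 2))).eq_zero_of_forall_le (hmin4 k)
  have hr1 : x1 (k + 1) - x2 (k + 1) = (τ * β)⁻¹ • (l1 k - l1 (k + 1)) := by
    rw [hdual1 k, sub_sub_cancel, inv_smul_smul₀ hτβ.ne']
  have hr2 : x3 (k + 1) - x4 (k + 1) = (τ * β)⁻¹ • (l2 k - l2 (k + 1)) := by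
    rw [hdual2 k, sub_sub_cancel, inv_smul_smul₀ hτβ.ne']
  have hf1 := (le_sqrt_sum_four _ _ _ _).1.trans
    (hfLip (x1 (k + 1)) (x2 (k + 1)) (x3 (k + 1)) (x4 (k + 1)) (x1 (k + 1)) (x2 k) (x3 k) (x4 k))
  have hf2 := (le_sqrt_sum_four _ _ _ _).2.1.trans
    (hfLip (x1 (k + 1)) (x2 (k + 1)) (x3 (k + 1)) (x4 (k + 1)) (x1 (k + 1)) (x2 (k + 1))
      (x3 k) (x4 k))
  have hf3 := (le_sqrt_sum_four _ _ _ _).2.2.1.trans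
    (hfLip (x1 (k + 1)) (x2 (k + 1)) (x3 (k + 1)) (x4 (k + 1)) (x1 (k + 1)) (x2 (k + 1))
      (x3 (k + 1)) (x4 k))
  have hg1 := (le_sqrt_sum_two _ _).1.trans
    (hgLip (x1 (k + 1)) (x2 (k + 1)) (x1 (k + 1)) (x2 k))
  obtain ⟨hd1, hd2, hd3, hd4⟩ := le_sqrt_sum_four ‖x1 (k + 1) - x1 k‖ ‖x2 (k + 1) - x2 k‖
    ‖x3 (k + 1) - x3 k‖ ‖x4 (k + 1) - x4 k‖
  obtain ⟨he1, he2⟩ := le_sqrt_sum_two ‖l1 (k + 1) - l1 k‖ ‖l2 (k + 1) - l2 k‖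
  have hD0 : 0 ≤ Real.sqrt (‖x1 (k + 1) - x1 k‖ ^ 2 + ‖x2 (k + 1) - x2 k‖ ^ 2 +
    ‖x3 (k + 1) - x3 k‖ ^ 2 + ‖x4 (k + 1) - x4 k‖ ^ 2) := Real.sqrt_nonneg _
  have hsteps : ∀ s : ℝ, s ≤ ‖x1 (k + 1) - x1 k‖ ^ 2 + ‖x2 (k + 1) - x2 k‖ ^ 2 +
      ‖x3 (k + 1) - x3 k‖ ^ 2 + ‖x4 (k + 1) - x4 k‖ ^ 2 →
      Real.sqrt s ≤ Real.sqrt (‖x1 (k + 1) - x1 k‖ ^ 2 + ‖x2 (k + 1) - x2 k‖ ^ 2 +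
        ‖x3 (k + 1) - x3 k‖ ^ 2 + ‖x4 (k + 1) - x4 k‖ ^ 2) := fun s hs => Real.sqrt_le_sqrt hs
  have hf1' := hf1.trans (mul_le_mul_of_nonneg_left (hsteps _ (by
    simp only [sub_self, norm_zero]
    linarith [sq_nonneg ‖x1 (k + 1) - x1 k‖])) hLf.le)
  have hf2' := hf2.trans (mul_le_mul_of_nonneg_left (hsteps _ (by
    simp only [sub_self, norm_zero]
    linarith [sq_nonneg ‖x1 (k + 1) - x1 k‖, sq_nonneg ‖x2 (k + 1) - x2 k‖])) hLf.le)
  have hf3' := hf3.trans (mul_le_mul_of_nonneg_left (hsteps _ (by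
    simp only [sub_self, norm_zero]
    linarith [sq_nonneg ‖x1 (k + 1) - x1 k‖, sq_nonneg ‖x2 (k + 1) - x2 k‖,
      sq_nonneg ‖x3 (k + 1) - x3 k‖])) hLf.le)
  have hg1' := hg1.trans (mul_le_mul_of_nonneg_left (hsteps _ (by
    simp only [sub_self, norm_zero]
    linarith [sq_nonneg ‖x1 (k + 1) - x1 k‖, sq_nonneg ‖x3 (k + 1) - x3 k‖,
      sq_nonneg ‖x4 (k + 1) - x4 k‖])) hLg.le)
  have hnonneg : 0 ≤ Real.sqrt (‖x1 k - x1 (k - 1)‖ ^ 2 + ‖x2 k - x2 (k - 1)‖ ^ 2 +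
    ‖x3 k - x3 (k - 1)‖ ^ 2 + ‖x4 k - x4 (k - 1)‖ ^ 2) := Real.sqrt_nonneg _
  clear hf1 hf2 hf3 hg1 hsteps
  generalize Real.sqrt (‖x1 (k + 1) - x1 k‖ ^ 2 + ‖x2 (k + 1) - x2 k‖ ^ 2 +
    ‖x3 (k + 1) - x3 k‖ ^ 2 + ‖x4 (k + 1) - x4 k‖ ^ 2) = D at *
  have hE0 : 0 ≤ Real.sqrt (‖l1 (k + 1) - l1 k‖ ^ 2 + ‖l2 (k + 1) - l2 k‖ ^ 2) :=
    Real.sqrt_nonneg _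
  generalize Real.sqrt (‖l1 (k + 1) - l1 k‖ ^ 2 + ‖l2 (k + 1) - l2 k‖ ^ 2) = E at *
  have prev4 : ∀ (M : Matrix (Fin n × Fin 4) (Fin n × Fin 4) ℝ) (p q : E4 n), ‖p - q‖ ≤ D →
      ‖qfGrad M (q - p)‖ ≤ ‖qfGrad M‖ * (D + E) := fun M p q h =>
    (qfGrad M).le_opNorm_of_le (by rw [norm_sub_rev]; linarith)
  have prev3 : ∀ (M : Matrix (Fin n × Fin 3) (Fin n × Fin 3) ℝ) (p q : E3 n), ‖p - q‖ ≤ D →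
      ‖qfGrad M (q - p)‖ ≤ ‖qfGrad M‖ * (D + E) := fun M p q h =>
    (qfGrad M).le_opNorm_of_le (by rw [norm_sub_rev]; linarith)
  have mult4 : ∀ p q : E4 n, ‖p - q‖ ≤ E →
      ‖(α1 / (τ * β)) • (2 : ℝ) • (p - q)‖ ≤ |α1 / (τ * β)| * 2 * (D + E) := fun p q h => by
    rw [norm_smul, norm_smul, Real.norm_eq_abs, Real.norm_two, mul_assoc]
    gcongr
    linarith
  have mult3 : ∀ p q : E3 n, ‖p - q‖ ≤ E →
      ‖(α1 / (τ * β)) • (2 : ℝ) • (p - q)‖ ≤ |α1 / (τ * β)| * 2 * (D + E) := fun p q h => by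
    rw [norm_smul, norm_smul, Real.norm_eq_abs, Real.norm_two, mul_assoc]
    gcongr
    linarith
  have hr1' : ‖-(x1 (k + 1) - x2 (k + 1))‖ ≤ (τ * β)⁻¹ * (D + E) := by
    rw [norm_neg, hr1, norm_smul, Real.norm_of_nonneg (inv_pos.2 hτβ).le, norm_sub_rev]
    gcongr
    linarith
  have hr2' : ‖-(x3 (k + 1) - x4 (k + 1))‖ ≤ (τ * β)⁻¹ * (D + E) := by
    rw [norm_neg, hr2, norm_smul, Real.norm_of_nonneg (inv_pos.2 hτβ).le, norm_sub_rev]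
    gcongr
    linarith
  have hm1 := (norm_add_le _ _).trans (add_le_add hr1' (mult4 (l1 (k + 1)) (l1 k) he1))
  have hm2 := (norm_add_le _ _).trans (add_le_add hr2' (mult3 (l2 (k + 1)) (l2 k) he2))
  have hq : ∀ {a b s : ℝ}, 0 ≤ a → 0 ≤ b → s ≤ D → (a + b) * s ≤ (a + b) * (D + E) :=
    fun ha hb hs => mul_le_mul_of_nonneg_left (by linarith) (add_nonneg ha hb)
  have hDL := mul_nonneg hLf.le hE0
  have hDG := mul_nonneg hLg.le hE0
  have hDβ := mul_nonneg hβ.le hE0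
  have hb1 := (norm_projM_le (hx1M (k + 1)) _).trans (norm_sub_prox_le M1 H1
    (grad1f f (x1 (k + 1)) (x2 k) (x3 k) (x4 k) + grad1g g (x1 (k + 1)) (x2 k) - l1 k +
      β • (x1 (k + 1) - x2 k))
    (grad1f f (x1 (k + 1)) (x2 (k + 1)) (x3 (k + 1)) (x4 (k + 1)) +
      grad1g g (x1 (k + 1)) (x2 (k + 1)) - l1 (k + 1) + β • (x1 (k + 1) - x2 (k + 1)))
    (x1 (k + 1) - x1 k))
  rw [projM_sub, opt1, sub_zero] at hb1
  have hb2 := norm_sub_prox_le M2 H2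
    (grad2f f (x1 (k + 1)) (x2 (k + 1)) (x3 k) (x4 k) + grad2g g (x1 (k + 1)) (x2 (k + 1)) +
      l1 k + β • (x2 (k + 1) - x1 (k + 1)))
    (grad2f f (x1 (k + 1)) (x2 (k + 1)) (x3 (k + 1)) (x4 (k + 1)) +
      grad2g g (x1 (k + 1)) (x2 (k + 1)) + l1 (k + 1) + β • (x2 (k + 1) - x1 (k + 1)))
    (x2 (k + 1) - x2 k)
  rw [opt2, sub_zero] at hb2
  have hb3 := norm_sub_prox_le M3 H3
    (grad3f f (x1 (k + 1)) (x2 (k + 1)) (x3 (k + 1)) (x4 k) - l2 k + β • (x3 (k + 1) - x4 k))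
    (grad3f f (x1 (k + 1)) (x2 (k + 1)) (x3 (k + 1)) (x4 (k + 1)) - l2 (k + 1) +
      β • (x3 (k + 1) - x4 (k + 1)))
    (x3 (k + 1) - x3 k)
  rw [opt3, sub_zero] at hb3
  have hb4 := norm_sub_prox_le M4 H4
    (grad4f f (x1 (k + 1)) (x2 (k + 1)) (x3 (k + 1)) (x4 (k + 1)) + l2 k +
      β • (x4 (k + 1) - x3 (k + 1)))
    (grad4f f (x1 (k + 1)) (x2 (k + 1)) (x3 (k + 1)) (x4 (k + 1)) + l2 (k + 1) +
      β • (x4 (k + 1) - x3 (k + 1)))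
    (x4 (k + 1) - x4 k)
  rw [opt4, sub_zero] at hb4
  have hG1 := norm_sub_add_smul_le (G := grad1f f (x1 (k + 1)) (x2 k) (x3 k) (x4 k) +
      grad1g g (x1 (k + 1)) (x2 k))
    (G' := grad1f f (x1 (k + 1)) (x2 (k + 1)) (x3 (k + 1)) (x4 (k + 1)) +
      grad1g g (x1 (k + 1)) (x2 (k + 1))) hβ.le (l1 k) (l1 (k + 1)) (x1 (k + 1)) (x2 k)
      (x2 (k + 1))
  have hG1' := (norm_add_le_of_le hf1' hg1')
  rw [← add_sub_add_comm] at hG1'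
  have hG3 := norm_sub_add_smul_le hβ.le
    (G := grad3f f (x1 (k + 1)) (x2 (k + 1)) (x3 (k + 1)) (x4 k))
    (G' := grad3f f (x1 (k + 1)) (x2 (k + 1)) (x3 (k + 1)) (x4 (k + 1)))
    (l2 k) (l2 (k + 1)) (x3 (k + 1)) (x4 k) (x4 (k + 1))
  rw [add_sub_add_right_eq_sub] at hb2 hb4
  rw [add_sub_add_left_eq_sub] at hb4
  have hG2 := norm_add_le_of_le hf2' he1
  rw [← add_sub_add_comm, ← add_sub_add_right_eq_sub _ _
    (grad2g g (x1 (k + 1)) (x2 (k + 1))), add_right_comm _ (l1 (k + 1)),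
    add_right_comm _ (l1 k)] at hG2
  have hβ2 := mul_le_mul_of_nonneg_left hd2 hβ.le
  have hβ4 := mul_le_mul_of_nonneg_left hd4 hβ.le
  have hq1 := hq (norm_nonneg (qfGrad M1)) (norm_nonneg (qfGrad H1)) hd1
  have hq2 := hq (norm_nonneg (qfGrad M2)) (norm_nonneg (qfGrad H2)) hd2
  have hq3 := hq (norm_nonneg (qfGrad M3)) (norm_nonneg (qfGrad H3)) hd3
  have hq4 := hq (norm_nonneg (qfGrad M4)) (norm_nonneg (qfGrad H4)) hd4
  refine (sqrt_add_sq_le (sqrt_add_sq_le (sqrt_add_sq_le (sqrt_add_sq_le (sqrt_add_sq_le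
    (sqrt_add_sq_le (sqrt_add_sq_le (sqrt_add_sq_le (sqrt_add_sq_le (sqrt_add_sq_le (sqrt_add_sq_le
    ((Real.sqrt_sq (norm_nonneg _)).le.trans
      (hb1.trans (c := (Lf + Lg + β + 1 + (‖qfGrad M1‖ + ‖qfGrad H1‖)) * (D + E)) ?_))
    (norm_nonneg _)
      (hb2.trans (c := (Lf + 1 + (‖qfGrad M2‖ + ‖qfGrad H2‖)) * (D + E)) ?_))
    (norm_nonneg _)
      (hb3.trans (c := (Lf + β + 1 + (‖qfGrad M3‖ + ‖qfGrad H3‖)) * (D + E)) ?_))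
    (norm_nonneg _)
      (hb4.trans (c := (1 + (‖qfGrad M4‖ + ‖qfGrad H4‖)) * (D + E)) ?_))
    (norm_nonneg _) ((norm_projM_le (hx1M k) _).trans (prev4 M1 _ _ hd1)))
    (norm_nonneg _) (prev4 M2 _ _ hd2)) (norm_nonneg _) (prev3 M3 _ _ hd3))
    (norm_nonneg _) (prev3 M4 _ _ hd4)) (norm_nonneg _) hm1) (norm_nonneg _) hm2)
    (norm_nonneg _) (mult4 _ _ ((norm_sub_rev _ _).le.trans he1)))
    (norm_nonneg _) (mult3 _ _ ((norm_sub_rev _ _).le.trans he2))).trans ?_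
  · linarith
  · linarith
  · linarith
  · linarith
  · calc _ = S * (D + E) := by rw [hS]; ring
      _ ≤ _ := by linarith

end
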